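/- arXiv:1108.1130 — 6 statements merged into one kernel-verified Lean document; each statement's English description precedes it below -/
import Mathlib

section
/- For every configuration C = (x,l,u) of size n there exists a configuration C' = (x',l',u') of size n such that: u'_i = u_i and e_i(C') = e_i(C) for all i, val(C') ≥ val(C), and for every i = 1,…,n both (l'_i + u'_i)/x'_i = e_i(C') (i.e. every edge is fully saturated, so the ceiling is attained with equality) and either l'_i = 0 or l'_i = 2 − x'_i. -/
/-- A configuration of size `n`: functions `x, l, u : {1,…,n} → ℝ≥0` with
`0 < x i ≤ 1`, `l i ≤ 2 - x i`, and `u i > 0 → l i = 2 - x i`. -/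
structure Config (n : ℕ) where
  x : Fin n → ℝ
  l : Fin n → ℝ
  u : Fin n → ℝ
  x_pos : ∀ i, 0 < x i
  x_le_one : ∀ i, x i ≤ 1
  l_nonneg : ∀ i, 0 ≤ l i
  l_le : ∀ i, l i ≤ 2 - x i
  u_nonneg : ∀ i, 0 ≤ u i
  u_pos_imp : ∀ i, 0 < u i → l i = 2 - x i

/-- The number of edges `⌈(l_i + u_i) / x_i⌉` used by the `i`-th element. -/
noncomputable def Config.e {n : ℕ} (C : Config n) (i : Fin n) : ℤ :=
  ⌈(C.l i + C.u i) / C.x i⌉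

/-- The value `∑_i max(0, l_i + u_i − 1)` of a configuration. -/
noncomputable def Config.val {n : ℕ} (C : Config n) : ℝ :=
  ∑ i, max 0 (C.l i + C.u i - 1)

/-- A single element with `⌈(l + u) / x⌉ = k` can be saturated without changing `u` or `k`
and without decreasing `l`. -/
theorem exists_saturated_element {x l u : ℝ} {k : ℤ} (hx : 0 < x) (hx1 : x ≤ 1) (hl : 0 ≤ l)
    (hlx : l ≤ 2 - x) (hu : 0 ≤ u) (hul : 0 < u → l = 2 - x) (hk : ⌈(l + u) / x⌉ = k) :
    ∃ x' l' : ℝ, 0 < x' ∧ x' ≤ 1 ∧ 0 ≤ l' ∧ l' ≤ 2 - x' ∧ (0 < u → l' = 2 - x') ∧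
      l ≤ l' ∧ (l' + u) / x' = k ∧ (l' = 0 ∨ l' = 2 - x') := by
  have hle : l + u ≤ k * x := (div_le_iff₀ hx).mp (hk ▸ Int.le_ceil _)
  rcases (add_nonneg hl hu).eq_or_lt with h0 | hpos
  · have hk0 : k = 0 := by rw [← hk, ← h0]; simp
    have hl0 : l = 0 := by linarith
    have hu0 : u = 0 := by linarith
    exact ⟨x, l, hx, hx1, hl, hlx, hul, le_rfl, by simp [hl0, hu0, hk0], Or.inl hl0⟩
  · have hk1 : (1 : ℝ) ≤ k := by
      have : 0 < k := hk ▸ Int.ceil_pos.mpr (div_pos hpos hx)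
      exact_mod_cast this
    have hk2 : (0 : ℝ) < k + 1 := by linarith
    have hx' : (2 + u) / (k + 1) ≤ 1 := by
      rw [div_le_one hk2]
      rcases hu.eq_or_lt with h | h
      · linarith
      · have := hul h
        nlinarith
    have hl' : l ≤ 2 - (2 + u) / (k + 1) := by
      rw [le_sub_comm, div_le_iff₀ hk2]
      nlinarith
    refine ⟨(2 + u) / (k + 1), 2 - (2 + u) / (k + 1), by positivity, hx', by linarith, le_rfl,
      fun _ => rfl, hl', ?_, Or.inr rfl⟩
    have : 2 + u ≠ 0 := by positivity
    field_simp
    ring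

theorem exists_saturated_config {n : ℕ} (C : Config n) :
    ∃ C' : Config n,
      (∀ i, C'.u i = C.u i) ∧
      (∀ i, C'.e i = C.e i) ∧
      C.val ≤ C'.val ∧
      (∀ i, (C'.l i + C'.u i) / C'.x i = (C'.e i : ℝ)) ∧
      (∀ i, C'.l i = 0 ∨ C'.l i = 2 - C'.x i) := by
  choose x l hx hx1 hl hlx hul hmono hsat hends using fun i =>
    exists_saturated_element (C.x_pos i) (C.x_le_one i) (C.l_nonneg i) (C.l_le i) (C.u_nonneg i)
      (C.u_pos_imp i) (rfl : _ = C.e i)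
  have he : ∀ i, ⌈(l i + C.u i) / x i⌉ = C.e i := fun i => by rw [hsat i, Int.ceil_intCast]
  refine ⟨⟨x, l, C.u, hx, hx1, hl, hlx, C.u_nonneg, hul⟩, fun _ => rfl, he, ?_, fun i => ?_, hends⟩
  · refine Finset.sum_le_sum fun i _ => max_le_max le_rfl ?_
    change C.l i + C.u i - 1 ≤ l i + C.u i - 1
    linarith [hmono i]
  · exact (hsat i).trans (congrArg _ (he i).symm)
end

section
/- Let x, l, u be real numbers with 0 < x ≤ 1, 0 ≤ l ≤ 2 − x, u ≥ 0, and such that u > 0 implies l = 2 − x. Let e = ⌈(l+u)/x⌉. Then max(0, l + u − 1) ≤ u + (e − u)/6. -/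
theorem per_element_bound (x l u : ℝ)
    (hx0 : 0 < x) (hx1 : x ≤ 1)
    (hl0 : 0 ≤ l) (hl : l ≤ 2 - x)
    (hu0 : 0 ≤ u) (hul : 0 < u → l = 2 - x) :
    max 0 (l + u - 1) ≤ u + ((⌈(l + u) / x⌉ : ℝ) - u) / 6 := by
  have hle : l + u ≤ (⌈(l + u) / x⌉ : ℝ) * x := (div_le_iff₀ hx0).mp (Int.le_ceil _)
  have hn0 : 0 ≤ ⌈(l + u) / x⌉ := Int.ceil_nonneg (by positivity)
  generalize ⌈(l + u) / x⌉ = n at hle hn0 ⊢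
  have hn0' : (0 : ℝ) ≤ n := by exact_mod_cast hn0
  refine max_le (by linarith) ?_
  rcases le_or_gt 5 n with h5 | h5
  · have h5' : (5 : ℝ) ≤ n := by exact_mod_cast h5
    rcases hu0.eq_or_lt with rfl | hu
    · rcases h5.eq_or_lt with rfl | h6
      · push_cast at *
        linarith
      · have h6' : (6 : ℝ) ≤ n := by exact_mod_cast h6
        linarith
    · have := hul hu
      nlinarith [mul_nonneg (sub_nonneg.mpr h5') (sub_nonneg.mpr hx1)]
  · rcases hu0.eq_or_lt with rfl | hu
    · interval_cases n <;> push_cast at * <;> linarith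
    · have := hul hu
      interval_cases n <;> push_cast at * <;> linarith
end

section
/- For every integer e ≥ 1 and every real number u with 0 ≤ u ≤ e, one has (e − u)·(1/6 − 1/(1+e)) + 1/(1+e) ≥ 0. (The integrality of e is essential: the claim fails for some real e ∈ (2,3) when u = 0.) -/
theorem key_integer_inequality (e : ℤ) (he : 1 ≤ e) (u : ℝ)
    (hu0 : 0 ≤ u) (hue : u ≤ (e : ℝ)) :
    0 ≤ ((e : ℝ) - u) * (1 / 6 - 1 / (1 + (e : ℝ))) + 1 / (1 + (e : ℝ)) := by
  have he' : (1 : ℝ) ≤ e := by exact_mod_cast he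
  have hprod : (0 : ℝ) ≤ ((e : ℝ) - 2) * (e - 3) := by
    have h : 0 ≤ (e - 2) * (e - 3) := by
      rcases le_or_gt e 2 with h | h
      · exact mul_nonneg_of_nonpos_of_nonpos (by lia) (by lia)
      · exact mul_nonneg (by lia) (by lia)
    exact_mod_cast h
  have hnum : 0 ≤ ((e : ℝ) - u) * (e - 5) + 6 := by
    rcases le_total (e : ℝ) 5 with h | h
    · linarith [mul_nonneg hu0 (sub_nonneg.2 h)]
    · linarith [mul_nonneg (sub_nonneg.2 hue) (sub_nonneg.2 h)]
  have heq : ((e : ℝ) - u) * (1 / 6 - 1 / (1 + (e : ℝ))) + 1 / (1 + (e : ℝ)) =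
      (((e : ℝ) - u) * (e - 5) + 6) / (6 * (1 + e)) := by
    have : (1 + (e : ℝ)) ≠ 0 := by positivity
    field_simp
    ring
  rw [heq]
  positivity
end

section
/- Let n be a natural number, let u* ≥ 0 be a real number, and let C = (x,l,u) be a configuration (of any size) with Σ_i u_i = u* which uses at most n edges, i.e. Σ_i e_i(C) ≤ n. Then val(C) ≤ u* + (1/6)(n − u*). -/
theorem Config.max_le_add_e {m : ℕ} (C : Config m) (i : Fin m) :
    max 0 (C.l i + C.u i - 1) ≤ C.u i + (1 / 6) * ((C.e i : ℝ) - C.u i) := by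
  have hx := C.x_pos i
  have hx1 := C.x_le_one i
  have hl := C.l_nonneg i
  have hl2 := C.l_le i
  have hu := C.u_nonneg i
  have he0 : (0 : ℝ) ≤ C.e i := by
    exact_mod_cast Int.ceil_nonneg (div_nonneg (add_nonneg hl hu) hx.le)
  have hex : C.l i + C.u i ≤ C.e i * C.x i := (div_le_iff₀ hx).1 (Int.le_ceil _)
  have hint : (0 : ℝ) ≤ ((C.e i : ℝ) - 2) * ((C.e i : ℝ) - 3) := by
    have h : (0 : ℤ) ≤ (C.e i - 2) * (C.e i - 3) := by
      rcases le_or_gt (C.e i) 2 with h | h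
      · exact mul_nonneg_of_nonpos_of_nonpos (by omega) (by omega)
      · exact mul_nonneg (by omega) (by omega)
    exact_mod_cast h
  generalize (C.e i : ℝ) = e at *
  refine max_le (by linarith) ?_
  rcases hu.eq_or_lt with h0 | hpos
  · rw [← h0] at hex ⊢
    have hle : C.l i * (e + 1) ≤ 2 * e := by nlinarith
    by_contra! h
    nlinarith
  · rw [C.u_pos_imp i hpos] at hex ⊢
    rcases le_total 5 e with h5 | h5
    · nlinarith
    · have hx2 : 2 ≤ (e + 1) * C.x i := by linarith
      by_contra! h
      nlinarith

theorem config_value_upper_bound {m : ℕ} (C : Config m) (n : ℕ) (ustar : ℝ)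
    (hustar : 0 ≤ ustar) (hu : ∑ i, C.u i = ustar)
    (he : ∑ i, C.e i ≤ (n : ℤ)) :
    C.val ≤ ustar + (1 / 6) * ((n : ℝ) - ustar) := by
  have he' : ∑ i, (C.e i : ℝ) ≤ n := by exact_mod_cast he
  calc C.val ≤ ∑ i, (C.u i + (1 / 6) * ((C.e i : ℝ) - C.u i)) :=
        Finset.sum_le_sum fun i _ => C.max_le_add_e i
    _ = ustar + (1 / 6) * (∑ i, (C.e i : ℝ) - ustar) := by
        rw [Finset.sum_add_distrib, ← Finset.mul_sum, Finset.sum_sub_distrib, hu]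
    _ ≤ ustar + (1 / 6) * ((n : ℝ) - ustar) := by linarith
end

section
/- For every natural number n ≥ 2 and every real number u* with 0 ≤ u* ≤ n − 2, there exists a configuration C = (x,l,u) of size n with Σ_i u_i = u* and Σ_i e_i(C) ≤ n such that val(C) ≥ u* + (1/6)(n − u*) − 1. Hence the bound val(C) ≤ u* + (1/6)(n − u*) for configurations using at most n edges is tight up to an additive constant. -/
theorem Fin.sum_ite_val_lt {M : Type*} [AddCommMonoid M] {m k : ℕ} (hk : k ≤ m) (c : M) :
    ∑ i : Fin m, (if i.val < k then c else 0) = k • c := by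
  rw [Fin.sum_univ_eq_sum_range (fun j => if j < k then c else 0) m, ← Finset.sum_filter,
    Finset.sum_const]
  congr 1
  rw [show {j ∈ Finset.range m | j < k} = Finset.range k by
    ext j
    simp only [Finset.mem_filter, Finset.mem_range]
    omega, Finset.card_range]

/-- One element with `u = t` and parameter `a`, then `k` elements with `x = 2 / 3`, `l = 4 / 3`
(two edges and value `1 / 3` each), then elements without edges. -/
noncomputable def Config.ofHead (m k : ℕ) (t a : ℝ) (ht : 0 ≤ t) (ha : 0 < a) (ha1 : a ≤ 1) :
    Config (m + 1) where
  x := Fin.cons a fun i => if i.val < k then 2 / 3 else 1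
  l := Fin.cons (2 - a) fun i => if i.val < k then 4 / 3 else 0
  u := Fin.cons t fun _ => 0
  x_pos := Fin.cases (by simpa) fun i => by
    simp only [Fin.cons_succ]; split_ifs <;> norm_num
  x_le_one := Fin.cases (by simpa) fun i => by
    simp only [Fin.cons_succ]; split_ifs <;> norm_num
  l_nonneg := Fin.cases (by simp only [Fin.cons_zero]; linarith) fun i => by
    simp only [Fin.cons_succ]; split_ifs <;> norm_num
  l_le := Fin.cases (by simp) fun i => by
    simp only [Fin.cons_succ]; split_ifs <;> norm_num
  u_nonneg := Fin.cases (by simpa) fun i => by simp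
  u_pos_imp := Fin.cases (by simp) fun i => by simp

theorem Config.sum_u_ofHead (m k : ℕ) (t a : ℝ) (ht : 0 ≤ t) (ha : 0 < a) (ha1 : a ≤ 1) :
    ∑ i, (ofHead m k t a ht ha ha1).u i = t := by
  simp [ofHead, Fin.sum_univ_succ]

theorem Config.sum_e_ofHead {m k : ℕ} (hk : k ≤ m) (t a : ℝ) (ht : 0 ≤ t) (ha : 0 < a)
    (ha1 : a ≤ 1) :
    ∑ i, (ofHead m k t a ht ha ha1).e i = ⌈(2 - a + t) / a⌉ + 2 * k := by
  have h (i : Fin m) : (ofHead m k t a ht ha ha1).e i.succ = if i.val < k then 2 else 0 := by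
    simp only [e, ofHead, Fin.cons_succ]
    split_ifs <;> norm_num
  rw [Fin.sum_univ_succ, Finset.sum_congr rfl fun i _ => h i, Fin.sum_ite_val_lt hk]
  simp [e, ofHead, mul_comm]

theorem Config.val_ofHead {m k : ℕ} (hk : k ≤ m) (t a : ℝ) (ht : 0 ≤ t) (ha : 0 < a)
    (ha1 : a ≤ 1) :
    (ofHead m k t a ht ha ha1).val = 1 - a + t + k / 3 := by
  have h (i : Fin m) : max 0 ((ofHead m k t a ht ha ha1).l i.succ +
      (ofHead m k t a ht ha ha1).u i.succ - 1) = if i.val < k then 1 / 3 else 0 := by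
    simp only [ofHead, Fin.cons_succ]
    split_ifs <;> norm_num
  rw [val, Fin.sum_univ_succ, Finset.sum_congr rfl fun i _ => h i, Fin.sum_ite_val_lt hk]
  simp only [ofHead, Fin.cons_zero, nsmul_eq_mul]
  rw [max_eq_right (by linarith)]
  ring

theorem config_value_lower_bound (n : ℕ) (hn : 2 ≤ n) (ustar : ℝ)
    (h0 : 0 ≤ ustar) (h1 : ustar ≤ (n : ℝ) - 2) :
    ∃ C : Config n,
      (∑ i, C.u i = ustar) ∧
      (∑ i, C.e i ≤ (n : ℤ)) ∧
      ustar + (1 / 6) * ((n : ℝ) - ustar) - 1 ≤ C.val := by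
  obtain ⟨m, rfl⟩ : ∃ m, n = m + 1 := ⟨n - 1, by omega⟩
  push_cast at h1
  obtain ⟨c, hc⟩ : ∃ c, c = ⌈ustar⌉₊ := ⟨_, rfl⟩
  have hc1 : ustar ≤ c := hc ▸ Nat.le_ceil ustar
  have hc2 : (c : ℝ) < ustar + 1 := hc ▸ Nat.ceil_lt_add_one h0
  have hcm : c < m + 1 := by
    have : (c : ℝ) < (m + 1 : ℕ) := by push_cast; linarith
    exact_mod_cast this
  obtain ⟨k, hk1, hk2⟩ : ∃ k, c + 1 + 2 * k ≤ m + 1 ∧ m + 1 ≤ c + 1 + 2 * k + 1 :=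
    ⟨(m - c) / 2, by omega, by omega⟩
  have hk2' : (m : ℝ) + 1 ≤ c + 1 + 2 * k + 1 := by exact_mod_cast hk2
  have hd : (0 : ℝ) < c + 2 := by positivity
  have ha : 0 < (2 + ustar) / (c + 2) := by positivity
  have ha1 : (2 + ustar) / (c + 2) ≤ 1 := by
    rw [div_le_one hd]
    linarith
  refine ⟨Config.ofHead m k ustar _ h0 ha ha1, Config.sum_u_ofHead .., ?_, ?_⟩
  · have he : (2 - (2 + ustar) / (c + 2) + ustar) / ((2 + ustar) / (c + 2)) =
        ((c + 1 : ℤ) : ℝ) := by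
      have : 2 + ustar ≠ 0 := by positivity
      push_cast
      field_simp
      ring
    rw [Config.sum_e_ofHead (by omega), he, Int.ceil_intCast]
    exact_mod_cast hk1
  · rw [Config.val_ofHead (by omega)]
    push_cast
    linarith
end

section
/- Let I be a finite set, let z, ε : I → ℝ be functions with z_w ≥ 0 and ε_w ≥ 0 for all w ∈ I, and let X be a real number. Let S = {w ∈ I : ε_w < 1} and for each w ∈ I set u_w = max(0, z_w − 2). Assume: (i) X ≥ 2; (ii) X ≥ Σ_{w∈I} z_w; (iii) z_w ≥ 2 − ε_w for every w ∈ S; and (iv) X ≥ Σ_{w∈S} z_w + max(0, 2 − Σ_{w∈S} ε_w). Then Σ_{w∈S} (1 − ε_w) ≤ (5/6)·(X − 2 − Σ_{w∈I} u_w). -/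
theorem local_correction_bound {ι : Type*} [Fintype ι] [DecidableEq ι]
    (z ε : ι → ℝ) (X : ℝ)
    (hz : ∀ w, 0 ≤ z w) (hε : ∀ w, 0 ≤ ε w)
    (S : Finset ι) (hS : ∀ w, w ∈ S ↔ ε w < 1)
    (hX2 : 2 ≤ X)
    (hXz : ∑ w, z w ≤ X)
    (hzε : ∀ w ∈ S, 2 - ε w ≤ z w)
    (hcut : ∑ w ∈ S, z w + max 0 (2 - ∑ w ∈ S, ε w) ≤ X) :
    ∑ w ∈ S, (1 - ε w) ≤ (5 / 6) * (X - 2 - ∑ w, max 0 (z w - 2)) := by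
  have hcard : ∑ w ∈ S, (1 - ε w) = S.card - ∑ w ∈ S, ε w := by simp
  have hεcard : ∑ w ∈ S, ε w ≤ S.card := by
    have h : 0 ≤ ∑ w ∈ S, (1 - ε w) :=
      Finset.sum_nonneg fun w hw => by linarith [(hS w).1 hw]
    linarith
  have hzS : ∑ w ∈ S, max 0 (z w - 2) + (2 * S.card - ∑ w ∈ S, ε w) ≤ ∑ w ∈ S, z w := by
    have h : ∑ w ∈ S, (max 0 (z w - 2) + (2 - ε w)) ≤ ∑ w ∈ S, z w := by
      refine Finset.sum_le_sum fun w hw => ?_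
      rcases max_cases 0 (z w - 2) with h | h <;> linarith [hzε w hw, hε w]
    simp only [Finset.sum_add_distrib, Finset.sum_sub_distrib, Finset.sum_const,
      nsmul_eq_mul] at h
    linarith
  have hz_split := Finset.sum_add_sum_compl S z
  have hu_split := Finset.sum_add_sum_compl S fun w => max 0 (z w - 2)
  have hε0 : 0 ≤ ∑ w ∈ S, ε w := Finset.sum_nonneg fun w _ => hε w
  have hA : 2 * S.card - ∑ w ∈ S, ε w - 2 + max 0 (2 - ∑ w ∈ S, ε w) ≤
      X - 2 - ∑ w, max 0 (z w - 2) := by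
    by_cases hT : ∃ v ∈ Sᶜ, 2 < z v
    · obtain ⟨v, hv, hzv⟩ := hT
      have hy : ∀ w, 0 ≤ z w - max 0 (z w - 2) := fun w => by
        rcases max_cases 0 (z w - 2) with h | h <;> linarith [hz w]
      have h := Finset.single_le_sum (fun w _ => hy w) hv
      rw [Finset.sum_sub_distrib, max_eq_right (by linarith : 0 ≤ z v - 2)] at h
      have hmax : max 0 (2 - ∑ w ∈ S, ε w) ≤ 2 := max_le (by norm_num) (by linarith)
      linarith
    · push Not at hT
      have h : ∑ w ∈ Sᶜ, max 0 (z w - 2) = 0 :=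
        Finset.sum_eq_zero fun w hw => max_eq_left (by linarith [hT w hw])
      linarith
  rw [hcard]
  rcases max_cases 0 (2 - ∑ w ∈ S, ε w) with h | h <;> linarith
end
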